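/- Fix α ∈ (1,∞) and 0 < c ≤ C. Let Λ be a nonempty finite set with N elements, Y a countable linearly ordered set, and for each λ ∈ Λ let M_λ and M'_λ be probability mass functions on Y. Let (p_k)_{k≥1} be a probability distribution on the positive integers with finite mean, let f(x) = Σ_{k≥1} p_k x^k be its probability generating function on [0,1], and let f' denote its derivative. Let σ and σ' be adaptive strategies with density bounds (c,C), and set A_1 = A(p,σ,M) and A_2 = A(p,σ',M'). Then there exists a function g : Y → [0,1] such that, writing q = Σ_{y∈Y} P⁺(y)·g(y) and q' = Σ_{y∈Y} P'⁻(y)·g(y), one has D_α(A_1‖A_2) ≤ max_{λ∈Λ} D_α(M_λ‖M'_λ) + (α/(α−1))·log(C/c) + (1/(α−1))·log( f'(q)^α · f'(q')^{1−α} ). -/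

import Mathlib

open scoped ENNReal BigOperators

/-- KL divergence (order-1 Rényi divergence) between two pmfs, valued in `EReal`. -/
noncomputable def klDiv' {Y : Type*} (p q : Y → ℝ≥0∞) : EReal :=
  open scoped Classical in
  if (∀ y, q y = 0 → p y = 0) ∧
      Summable (fun y => (p y).toReal * Real.log ((p y).toReal / (q y).toReal)) then
    ((∑' y, (p y).toReal * Real.log ((p y).toReal / (q y).toReal) : ℝ) : EReal)
  else ⊤

/-- Rényi divergence of order `α` between two pmfs on a countable set, valued in `EReal`. -/
noncomputable def renyiDiv {Y : Type*} (α : ℝ) (p q : Y → ℝ≥0∞) : EReal :=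
  open scoped Classical in
  if α = 1 then klDiv' p q
  else (((α - 1)⁻¹ : ℝ) : EReal) * ENNReal.log (∑' y, p y ^ α * q y ^ (1 - α))

/-- Probability of generating the sequence `ys` (given history `hist`) in the adaptive
process: at each step, sample `λ` from the strategy applied to the history so far,
then sample the next output from `M λ`. -/
noncomputable def seqProb {Λ Y : Type*} [Fintype Λ]
    (σ : List Y → Λ → ℝ≥0∞) (M : Λ → Y → ℝ≥0∞) : List Y → List Y → ℝ≥0∞
  | _, [] => 1
  | hist, y :: ys => (∑ l : Λ, σ hist l * M l y) * seqProb σ M (hist ++ [y]) ys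

/-- The DP-HyPO output distribution `A(p, σ, M)` : sample `T = k` with probability `p k`
(for `k ≥ 1`), run the adaptive process for `k` steps, and output the maximum. -/
noncomputable def hypoOut {Λ Y : Type*} [Fintype Λ] [LinearOrder Y]
    (p : ℕ → ℝ≥0∞) (σ : List Y → Λ → ℝ≥0∞) (M : Λ → Y → ℝ≥0∞) (y : Y) : ℝ≥0∞ :=
  ∑' k : ℕ, p (k + 1) *
    ∑' l : {l : List Y // l.length = k + 1 ∧ l.maximum = (y : WithBot Y)},
      seqProb σ M [] l.1

/-- `σ` is an adaptive strategy with density bounds `(c, C)`: to every history it assigns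
a probability vector on `Λ` whose entries lie in `[c/N, C/N]` where `N = card Λ`. -/
def IsStrategy {Λ Y : Type*} [Fintype Λ] (c C : ℝ) (σ : List Y → Λ → ℝ≥0∞) : Prop :=
  ∀ h : List Y, (∑ l : Λ, σ h l) = 1 ∧
    ∀ l : Λ, ENNReal.ofReal (c / Fintype.card Λ) ≤ σ h l ∧
      σ h l ≤ ENNReal.ofReal (C / Fintype.card Λ)

/-- The probability mass function of the truncated negative binomial distribution
`NegBin(θ, γ)` at `k`. -/
noncomputable def negBinPMF (θ γ : ℝ) (k : ℕ) : ℝ :=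
  open scoped Classical in
  if θ = 0 then (1 - γ) ^ k / (k * Real.log (1 / γ))
  else (1 - γ) ^ k / (γ ^ (-θ) - 1) * ∏ ℓ ∈ Finset.range k, ((ℓ : ℝ) + θ) / ((ℓ : ℝ) + 1)

/-- The mean of the truncated negative binomial distribution `NegBin(θ, γ)`. -/
noncomputable def negBinMean (θ γ : ℝ) : ℝ :=
  open scoped Classical in
  if θ = 0 then (1 / γ - 1) / Real.log (1 / γ)
  else θ * (1 - γ) / (γ * (1 - γ ^ θ))

/-- The set `S_{C,c}` of probability vectors on `Λ` with entries in `[c/N, C/N]`. -/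
def densitySet (Λ : Type*) [Fintype Λ] (c C : ℝ) : Set (Λ → ℝ≥0∞) :=
  {π | (∀ l : Λ, ENNReal.ofReal (c / Fintype.card Λ) ≤ π l ∧
      π l ≤ ENNReal.ofReal (C / Fintype.card Λ)) ∧ ∑ l : Λ, π l = 1}

/-- `P⁺(y) = sup_{π ∈ S_{C,c}} Σ_λ π(λ) M_λ(y)`. -/
noncomputable def Pplus {Λ Y : Type*} [Fintype Λ] (c C : ℝ)
    (M : Λ → Y → ℝ≥0∞) (y : Y) : ℝ≥0∞ :=
  ⨆ π ∈ densitySet Λ c C, ∑ l : Λ, π l * M l y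

/-- `P⁻(y) = inf_{π ∈ S_{C,c}} Σ_λ π(λ) M_λ(y)`. -/
noncomputable def Pminus {Λ Y : Type*} [Fintype Λ] (c C : ℝ)
    (M : Λ → Y → ℝ≥0∞) (y : Y) : ℝ≥0∞ :=
  ⨅ π ∈ densitySet Λ c C, ∑ l : Λ, π l * M l y


/-! ### Analysis of the generating function -/

theorem hy_tangent {α x y r : ℝ} (hα : 1 < α) (hx : 0 < x) (hy : 0 < y) (hr : 0 < r) :
    α * r ^ (α - 1) * x - (α - 1) * r ^ α * y ≤ x ^ α * y ^ (1 - α) := by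
  have hb := one_add_mul_self_le_rpow_one_add (s := x / (y * r) - 1)
    (by have : 0 < x / (y * r) := by positivity
        linarith) hα.le
  have e1 : 1 + (x / (y * r) - 1) = x / (y * r) := by ring
  rw [e1, Real.div_rpow hx.le (by positivity), Real.mul_rpow hy.le hr.le] at hb
  have hyα : 0 < y ^ α := by positivity
  have hrα : 0 < r ^ α := by positivity
  have e2 : r ^ (α - 1) = r ^ α / r := by rw [Real.rpow_sub_one hr.ne']
  have e3 : y ^ (1 - α) = y / y ^ α := by rw [Real.rpow_sub hy, Real.rpow_one]
  rw [e2, e3]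
  have hb2 := mul_le_mul_of_nonneg_left hb (show 0 ≤ r ^ α * y by positivity)
  calc _ = r ^ α * y * (1 + α * (x / (y * r) - 1)) := by field_simp; ring
    _ ≤ _ := hb2
    _ = _ := by field_simp

section gen
variable {w : ℕ → ℝ} {f : ℝ → ℝ}

theorem hy_summable (hw : ∀ k, 0 ≤ w k) (hm : Summable fun k : ℕ => ((k : ℝ) + 1) * w k) :
    Summable w :=
  Summable.of_nonneg_of_le hw (fun k => by
    have := hw k
    nlinarith [(Nat.cast_nonneg k : (0 : ℝ) ≤ k)]) hm

theorem hy_hasDeriv (hw : ∀ k, 0 ≤ w k) (hm : Summable fun k : ℕ => ((k : ℝ) + 1) * w k)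
    (hf : ∀ x : ℝ, f x = ∑' k : ℕ, w k * x ^ (k + 1)) {x : ℝ} (hx0 : -1 < x) (hx1 : x < 1) :
    HasDerivAt f (∑' k : ℕ, ((k : ℝ) + 1) * w k * x ^ k) x := by
  have hff : f = fun z => ∑' k : ℕ, w k * z ^ (k + 1) := funext hf
  rw [hff]
  refine hasDerivAt_tsum_of_isPreconnected (F := ℝ) (g := fun k z => w k * z ^ (k + 1))
    (g' := fun k z => ((k : ℝ) + 1) * w k * z ^ k) (t := Set.Ioo (-1 : ℝ) 1) (y₀ := 0) hm isOpen_Ioo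
    isPreconnected_Ioo ?_ ?_ (by simp) ?_ ⟨hx0, hx1⟩
  · intro n y hy
    have := ((hasDerivAt_pow (n + 1) y).const_mul (w n))
    have e : w n * (((n + 1 : ℕ) : ℝ) * y ^ (n + 1 - 1)) = ((n : ℝ) + 1) * w n * y ^ n := by
      rw [Nat.add_sub_cancel]
      push_cast
      ring
    rw [e] at this
    exact this
  · intro n y hy
    have h1 : |y| ≤ 1 := abs_le.2 ⟨hy.1.le, hy.2.le⟩
    rw [Real.norm_eq_abs, abs_mul, abs_pow,
      abs_of_nonneg (mul_nonneg (by positivity) (hw n))]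
    exact mul_le_of_le_one_right (mul_nonneg (by positivity) (hw n))
      (pow_le_one₀ (abs_nonneg _) h1)
  · simp

theorem hy_contOn (hw : ∀ k, 0 ≤ w k) (hm : Summable fun k : ℕ => ((k : ℝ) + 1) * w k)
    (hf : ∀ x : ℝ, f x = ∑' k : ℕ, w k * x ^ (k + 1)) :
    ContinuousOn f (Set.Icc 0 1) := by
  have hff : f = fun z => ∑' k : ℕ, w k * z ^ (k + 1) := funext hf
  rw [hff]
  refine continuousOn_tsum (fun i => by fun_prop) (hy_summable hw hm) ?_
  intro n x hx
  rw [Real.norm_eq_abs, abs_of_nonneg (mul_nonneg (hw n) (pow_nonneg hx.1 _))]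
  exact mul_le_of_le_one_right (hw n) (pow_le_one₀ hx.1 hx.2)

theorem hy_sum_deriv (hw : ∀ k, 0 ≤ w k) (hm : Summable fun k : ℕ => ((k : ℝ) + 1) * w k)
    {x : ℝ} (hx0 : 0 ≤ x) (hx1 : x ≤ 1) :
    Summable fun k : ℕ => ((k : ℝ) + 1) * w k * x ^ k :=
  Summable.of_nonneg_of_le
    (fun k => mul_nonneg (mul_nonneg (by positivity) (hw k)) (pow_nonneg hx0 _))
    (fun k => mul_le_of_le_one_right (mul_nonneg (by positivity) (hw k)) (pow_le_one₀ hx0 hx1)) hm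

/-- two-sided bounds of the derivative. -/
theorem hy_deriv_bounds (hw : ∀ k, 0 ≤ w k) (hsum : ∑' k, w k = 1)
    (hm : Summable fun k : ℕ => ((k : ℝ) + 1) * w k)
    (hf : ∀ x : ℝ, f x = ∑' k : ℕ, w k * x ^ (k + 1)) :
    ∃ (m : ℕ) (κ μ : ℝ), 0 < κ ∧ 0 < μ ∧ ∀ x : ℝ, 0 < x → x < 1 →
      κ * x ^ m ≤ deriv f x ∧ deriv f x ≤ μ * x ^ m := by
  classical
  have hex : ∃ k, w k ≠ 0 := by
    by_contra! h
    simp [h] at hsum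
  let m := Nat.find hex
  have hmm : w m ≠ 0 := Nat.find_spec hex
  have hmin : ∀ k < m, w k = 0 := fun k hk => by
    have := Nat.find_min hex hk
    simpa using this
  have hpos : 0 < w m := lt_of_le_of_ne (hw m) hmm.symm
  have hnn : ∀ k : ℕ, 0 ≤ ((k : ℝ) + 1) * w k := fun k => mul_nonneg (by positivity) (hw k)
  refine ⟨m, ((m : ℝ) + 1) * w m, ∑' k : ℕ, ((k : ℝ) + 1) * w k, by positivity, ?_, ?_⟩
  · exact hm.tsum_pos hnn m (by positivity)
  · intro x hx0 hx1
    rw [(hy_hasDeriv hw hm hf (by linarith) hx1).deriv]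
    have hs := hy_sum_deriv hw hm hx0.le hx1.le
    constructor
    · exact hs.le_tsum m (fun k _ => mul_nonneg (hnn k) (pow_nonneg hx0.le _))
    · rw [← tsum_mul_right]
      refine hs.tsum_le_tsum ?_ (hm.mul_right _)
      intro k
      by_cases hk : k < m
      · simp [hmin k hk]
      · exact mul_le_mul_of_nonneg_left
          (pow_le_pow_of_le_one hx0.le hx1.le (not_lt.1 hk)) (hnn k)

theorem hy_deriv_pos (hw : ∀ k, 0 ≤ w k) (hsum : ∑' k, w k = 1)
    (hm : Summable fun k : ℕ => ((k : ℝ) + 1) * w k)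
    (hf : ∀ x : ℝ, f x = ∑' k : ℕ, w k * x ^ (k + 1)) {x : ℝ} (hx0 : 0 < x) (hx1 : x < 1) :
    0 < deriv f x := by
  obtain ⟨m, κ, μ, hκ, hμ, h⟩ := hy_deriv_bounds hw hsum hm hf
  exact lt_of_lt_of_le (by positivity) (h x hx0 hx1).1

theorem hy_slope_pos (hw : ∀ k, 0 ≤ w k) (hsum : ∑' k, w k = 1)
    (hm : Summable fun k : ℕ => ((k : ℝ) + 1) * w k)
    (hf : ∀ x : ℝ, f x = ∑' k : ℕ, w k * x ^ (k + 1)) {a b : ℝ} (ha : 0 ≤ a) (hab : a < b)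
    (hb : b ≤ 1) : 0 < (f b - f a) / (b - a) := by
  obtain ⟨x, hx, he⟩ := exists_hasDerivAt_eq_slope f (deriv f) hab
    ((hy_contOn hw hm hf).mono (Set.Icc_subset_Icc ha hb)) (fun x hx =>
      (hy_hasDeriv hw hm hf (by linarith [hx.1]) (by linarith [hx.2])).differentiableAt.hasDerivAt)
  rw [← he]
  exact hy_deriv_pos hw hsum hm hf (by linarith [hx.1]) (by linarith [hx.2])

theorem hy_core {α : ℝ} (hα : 1 < α) (hw : ∀ k, 0 ≤ w k) (hsum : ∑' k, w k = 1)
    (hm : Summable fun k : ℕ => ((k : ℝ) + 1) * w k)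
    (hf : ∀ x : ℝ, f x = ∑' k : ℕ, w k * x ^ (k + 1)) {a b a' b' : ℝ}
    (ha : 0 ≤ a) (hab : a < b) (hb : b ≤ 1) (ha' : 0 ≤ a') (hab' : a' < b') (hb' : b' ≤ 1) :
    ∃ u : ℝ, 0 < u ∧ u < 1 ∧
      ((f b - f a) / (b - a)) ^ α * ((f b' - f a') / (b' - a')) ^ (1 - α) ≤
        deriv f (a + u * (b - a)) ^ α * deriv f (a' + u * (b' - a')) ^ (1 - α) := by
  set A := (f b - f a) / (b - a) with hA
  set B := (f b' - f a') / (b' - a') with hB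
  have hApos : 0 < A := hy_slope_pos hw hsum hm hf ha hab hb
  have hBpos : 0 < B := hy_slope_pos hw hsum hm hf ha' hab' hb'
  have hba : 0 < b - a := by linarith
  have hba' : 0 < b' - a' := by linarith
  set r := A / B with hr
  have hrpos : 0 < r := by positivity
  set K1 := α * r ^ (α - 1)
  set K2 := (α - 1) * r ^ α
  have key : ∀ a b : ℝ, 0 ≤ a → a < b → b ≤ 1 → 
      ContinuousOn (fun u : ℝ => f (a + u * (b - a)) / (b - a)) (Set.Icc 0 1) ∧
      ∀ u ∈ Set.Ioo (0 : ℝ) 1, HasDerivAt (fun u : ℝ => f (a + u * (b - a)) / (b - a))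
        (deriv f (a + u * (b - a))) u := by
    intro a b ha hab hb
    have hba : 0 < b - a := by linarith
    constructor
    · refine ContinuousOn.div_const ?_ _
      refine (hy_contOn hw hm hf).comp (by fun_prop) ?_
      intro u hu
      constructor
      · have := mul_nonneg hu.1 hba.le
        linarith
      · nlinarith [hu.2]
    · intro u hu
      have h0 : 0 < u * (b - a) := mul_pos hu.1 hba
      have h1 : u * (b - a) < b - a := by nlinarith [hu.2]
      have hd := (hy_hasDeriv hw hm hf (x := a + u * (b - a)) (by linarith)
        (by linarith)).differentiableAt.hasDerivAt
      have hl : HasDerivAt (fun u : ℝ => a + u * (b - a)) (b - a) u := by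
        simpa using ((hasDerivAt_id u).mul_const (b - a)).const_add a
      have := (hd.comp u hl).div_const (b - a)
      rw [mul_div_assoc, div_self hba.ne', mul_one] at this
      exact this
  obtain ⟨c1, d1⟩ := key a b ha hab hb
  obtain ⟨c2, d2⟩ := key a' b' ha' hab' hb'
  obtain ⟨u, hu, he⟩ := exists_hasDerivAt_eq_slope
    (fun u : ℝ => K1 * (f (a + u * (b - a)) / (b - a)) - K2 * (f (a' + u * (b' - a')) / (b' - a')))
    (fun u => K1 * deriv f (a + u * (b - a)) - K2 * deriv f (a' + u * (b' - a')))
    zero_lt_one ((c1.const_smul K1).sub (c2.const_smul K2))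
    (fun u hu => ((d1 u hu).const_mul K1).sub ((d2 u hu).const_mul K2))
  refine ⟨u, hu.1, hu.2, ?_⟩
  have p1 : 0 < deriv f (a + u * (b - a)) := by
    have h0 : 0 < u * (b - a) := mul_pos hu.1 hba
    have h1 : u * (b - a) < b - a := by nlinarith [hu.2]
    exact hy_deriv_pos hw hsum hm hf (by linarith) (by linarith)
  have p2 : 0 < deriv f (a' + u * (b' - a')) := by
    have h0 : 0 < u * (b' - a') := mul_pos hu.1 hba'
    have h1 : u * (b' - a') < b' - a' := by nlinarith [hu.2]
    exact hy_deriv_pos hw hsum hm hf (by linarith) (by linarith)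
  refine le_trans (le_of_eq ?_) (hy_tangent hα p1 p2 hrpos)
  have e : K1 * A - K2 * B =
      K1 * deriv f (a + u * (b - a)) - K2 * deriv f (a' + u * (b' - a')) := by
    rw [he]
    simp only [hA, hB]
    have e1 : a + 1 * (b - a) = b := by ring
    have e2 : a' + 1 * (b' - a') = b' := by ring
    rw [e1, e2]
    simp only [zero_mul, add_zero, sub_zero, div_one]
    ring
  rw [← e]
  have hB' : A = r * B := by rw [hr]; field_simp
  simp only [K1, K2]
  rw [hB', Real.mul_rpow hrpos.le hBpos.le, mul_assoc, ← Real.rpow_add hBpos,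
    Real.rpow_sub_one hrpos.ne']
  simp
  field_simp
  ring

/-- the geometric-type sums. -/
def geoS {R : Type*} [CommSemiring R] (a b : R) : ℕ → R
  | 0 => 0
  | k + 1 => b ^ k + a * geoS a b k

theorem geoS_eq (a b : ℝ) (k : ℕ) : (b - a) * geoS a b k = b ^ k - a ^ k := by
  induction k with
  | zero => simp [geoS]
  | succ k ih =>
    simp only [geoS]
    have : (b - a) * (b ^ k + a * geoS a b k) = (b - a) * b ^ k + a * ((b - a) * geoS a b k) := by
      ring
    rw [this, ih]; ring

theorem geoS_nonneg {a b : ℝ} (ha : 0 ≤ a) (hb : 0 ≤ b) (k : ℕ) : 0 ≤ geoS a b k := by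
  induction k with
  | zero => simp [geoS]
  | succ k ih => simp only [geoS]; positivity

theorem geoS_ofReal {a b : ℝ} (ha : 0 ≤ a) (hb : 0 ≤ b) (k : ℕ) :
    geoS (ENNReal.ofReal a) (ENNReal.ofReal b) k = ENNReal.ofReal (geoS a b k) := by
  induction k with
  | zero => simp [geoS]
  | succ k ih =>
    simp only [geoS]
    rw [ih, ENNReal.ofReal_add (by positivity) (mul_nonneg ha (geoS_nonneg ha hb k)),
      ENNReal.ofReal_mul ha, ENNReal.ofReal_pow hb]

theorem hy_tsum_geo (hw : ∀ k, 0 ≤ w k)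
    (hm : Summable fun k : ℕ => ((k : ℝ) + 1) * w k)
    (hf : ∀ x : ℝ, f x = ∑' k : ℕ, w k * x ^ (k + 1)) {a b P : ℝ}
    (ha : 0 ≤ a) (hab : a < b) (hb : b ≤ 1) :
    ∑' k : ℕ, ENNReal.ofReal (w k) * (ENNReal.ofReal P *
      geoS (ENNReal.ofReal a) (ENNReal.ofReal b) (k + 1)) =
      ENNReal.ofReal P * ENNReal.ofReal ((f b - f a) / (b - a)) := by
  have hba : 0 < b - a := by linarith
  have hb0 : 0 ≤ b := by linarith
  have sm : ∀ x : ℝ, 0 ≤ x → x ≤ 1 → Summable fun k : ℕ => w k * x ^ (k + 1) := fun x h0 h1 =>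
    Summable.of_nonneg_of_le (fun k => mul_nonneg (hw k) (pow_nonneg h0 _))
      (fun k => mul_le_of_le_one_right (hw k) (pow_le_one₀ h0 h1)) (hy_summable hw hm)
  have e : ∀ k : ℕ, w k * geoS a b (k + 1) =
      (w k * b ^ (k + 1) - w k * a ^ (k + 1)) / (b - a) := by
    intro k
    rw [eq_div_iff hba.ne', mul_assoc, mul_comm _ (b - a), geoS_eq]; ring
  have hs : HasSum (fun k => w k * geoS a b (k + 1)) ((f b - f a) / (b - a)) := by
    simp only [e]
    rw [hf, hf]
    exact ((sm b hb0 hb).hasSum.sub (sm a ha (by linarith)).hasSum).div_const _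
  rw [← hs.tsum_eq, ENNReal.ofReal_tsum_of_nonneg
    (fun k => mul_nonneg (hw k) (geoS_nonneg ha hb0 _)) hs.summable, ← ENNReal.tsum_mul_left]
  refine tsum_congr fun k => ?_
  rw [geoS_ofReal ha hb0, ENNReal.ofReal_mul (hw k)]
  ring

end gen

/-! ### A reverse Hölder inequality -/

theorem hy_holder {ι : Type*} {α : ℝ} (hα : 1 < α) (a b : ι → ℝ≥0∞)
    (hb : ∑' i, b i ≠ ⊤) :
    (∑' i, a i) ^ α * (∑' i, b i) ^ (1 - α) ≤ ∑' i, a i ^ α * b i ^ (1 - α) := by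
  have hα0 : 0 < α := by linarith
  have hbi : ∀ i, b i ≠ ⊤ := fun i => ENNReal.ne_top_of_tsum_ne_top hb i
  by_cases hz : ∃ i, b i = 0 ∧ a i ≠ 0
  · obtain ⟨i, h1, h2⟩ := hz
    have : a i ^ α * b i ^ (1 - α) = ⊤ := by
      rw [h1, ENNReal.zero_rpow_of_neg (by linarith), ENNReal.mul_top]
      simp [h2, hα0.le]
    have h := ENNReal.le_tsum (f := fun i => a i ^ α * b i ^ (1 - α)) i
    rw [this] at h
    exact le_top.trans h
  push Not at hz
  by_cases hB0 : ∑' i, b i = 0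
  · have : ∀ i, a i = 0 := fun i => hz i (ENNReal.tsum_eq_zero.1 hB0 i)
    simp [this, hα0]
  let _ : MeasurableSpace ι := ⊤
  have hconj : α.HolderConjugate (α / (α - 1)) := Real.HolderConjugate.conjExponent hα
  have H := ENNReal.lintegral_mul_le_Lp_mul_Lq (MeasureTheory.Measure.count (α := ι)) hconj
    (f := fun i => a i * b i ^ ((1 - α) / α)) (g := fun i => b i ^ ((α - 1) / α))
    (measurable_from_top.aemeasurable) (measurable_from_top.aemeasurable)
  simp only [MeasureTheory.lintegral_count, Pi.mul_apply] at H
  have e1 : ∀ i, a i * b i ^ ((1 - α) / α) * b i ^ ((α - 1) / α) = a i := by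
    intro i
    by_cases h0 : b i = 0
    · simp [hz i h0]
    · rw [mul_assoc, ← ENNReal.rpow_add _ _ h0 (hbi i)]
      have : (1 - α) / α + (α - 1) / α = 0 := by ring
      simp [this]
  have e2 : ∀ i, (a i * b i ^ ((1 - α) / α)) ^ α = a i ^ α * b i ^ (1 - α) := by
    intro i
    rw [ENNReal.mul_rpow_of_nonneg _ _ hα0.le, ← ENNReal.rpow_mul]
    congr 2
    field_simp
  have e3 : ∀ i, (b i ^ ((α - 1) / α)) ^ (α / (α - 1)) = b i := by
    intro i
    rw [← ENNReal.rpow_mul]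
    have : (α - 1) / α * (α / (α - 1)) = 1 := by
      have : α - 1 ≠ 0 := by linarith
      field_simp
    simp [this]
  simp only [e1, e2, e3] at H
  have H2 := ENNReal.rpow_le_rpow H hα0.le
  rw [ENNReal.mul_rpow_of_nonneg _ _ hα0.le, ← ENNReal.rpow_mul, ← ENNReal.rpow_mul] at H2
  have e4 : 1 / α * α = 1 := by field_simp
  have e5 : 1 / (α / (α - 1)) * α = α - 1 := by field_simp
  rw [e4, e5, ENNReal.rpow_one] at H2
  calc _ ≤ ((∑' i, a i ^ α * b i ^ (1 - α)) * (∑' i, b i) ^ (α - 1)) * (∑' i, b i) ^ (1 - α) := by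
        gcongr
    _ = _ := by
        rw [mul_assoc, ← ENNReal.rpow_add _ _ hB0 hb]
        simp

theorem hy_rpow_anti {α : ℝ} (hα : 1 < α) {x y : ℝ≥0∞} (h : x ≤ y) :
    y ^ (1 - α) ≤ x ^ (1 - α) := by
  have : 1 - α = -(α - 1) := by ring
  rw [this, ENNReal.rpow_neg, ENNReal.rpow_neg]
  exact ENNReal.inv_le_inv.2 (ENNReal.rpow_le_rpow h (by linarith))

/-! ### The adaptive process -/

section adaptive
variable {Λ Y : Type*} [Fintype Λ] [LinearOrder Y]

/-- one step probability -/
noncomputable def stepP (σ : List Y → Λ → ℝ≥0∞) (M : Λ → Y → ℝ≥0∞) (h : List Y) (z : Y) : ℝ≥0∞ :=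
  ∑ l : Λ, σ h l * M l z

open scoped Classical in
/-- probability that all values are at most `y`. -/
noncomputable def Lsum (σ : List Y → Λ → ℝ≥0∞) (M : Λ → Y → ℝ≥0∞) (y : Y) (k : ℕ) (h : List Y) :
    ℝ≥0∞ :=
  ∑' l : List Y, if l.length = k ∧ ∀ x ∈ l, x ≤ y then seqProb σ M h l else 0

open scoped Classical in
/-- probability that the maximum is `y`. -/
noncomputable def Gsum (σ : List Y → Λ → ℝ≥0∞) (M : Λ → Y → ℝ≥0∞) (y : Y) (k : ℕ) (h : List Y) :
    ℝ≥0∞ :=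
  ∑' l : List Y, if l.length = k ∧ y ∈ l ∧ ∀ x ∈ l, x ≤ y then seqProb σ M h l else 0

theorem tsum_list_cons {Y : Type*} (F : List Y → ℝ≥0∞) (h : F [] = 0) :
    ∑' l, F l = ∑' z, ∑' l, F (z :: l) := by
  rw [← ENNReal.tsum_prod (f := fun z l => F (z :: l))]
  symm
  refine Function.Injective.tsum_eq (g := fun p : Y × List Y => p.1 :: p.2) ?_ ?_
  · rintro ⟨a, b⟩ ⟨c, d⟩ h
    simpa using h
  · intro l hl
    cases l with
    | nil => exact absurd h hl
    | cons z l => exact ⟨(z, l), rfl⟩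

variable (σ : List Y → Λ → ℝ≥0∞) (M : Λ → Y → ℝ≥0∞) (y : Y)

theorem Lsum_zero (h : List Y) : Lsum σ M y 0 h = 1 := by
  unfold Lsum
  rw [tsum_eq_single []]
  · simp [seqProb]
  · intro l hl
    simp [hl]

theorem Gsum_zero (h : List Y) : Gsum σ M y 0 h = 0 := by
  unfold Gsum
  rw [ENNReal.tsum_eq_zero]
  intro l
  rw [if_neg]
  rintro ⟨h1, h2, -⟩
  simp [List.length_eq_zero_iff.1 h1] at h2

theorem Lsum_succ (k : ℕ) (h : List Y) : Lsum σ M y (k + 1) h =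
    ∑' z, (if z ≤ y then stepP σ M h z else 0) * Lsum σ M y k (h ++ [z]) := by
  unfold Lsum
  rw [tsum_list_cons _ (by simp)]
  refine tsum_congr fun z => ?_
  rw [← ENNReal.tsum_mul_left]
  refine tsum_congr fun l => ?_
  by_cases hz : z ≤ y
  · simp [hz, seqProb, stepP]
  · simp [hz]

theorem Gsum_succ (k : ℕ) (h : List Y) : Gsum σ M y (k + 1) h =
    stepP σ M h y * Lsum σ M y k (h ++ [y]) +
    ∑' z, (if z < y then stepP σ M h z else 0) * Gsum σ M y k (h ++ [z]) := by
  have e : stepP σ M h y * Lsum σ M y k (h ++ [y]) =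
      ∑' z, if z = y then stepP σ M h z * Lsum σ M y k (h ++ [z]) else 0 := by
    rw [tsum_eq_single y (fun z hz => by simp [hz])]
    simp
  rw [e, ← ENNReal.tsum_add]
  unfold Gsum
  rw [tsum_list_cons _ (by simp)]
  refine tsum_congr fun z => ?_
  unfold Lsum
  rcases lt_trichotomy z y with hz | hz | hz
  · rw [if_neg hz.ne, if_pos hz, zero_add, ← ENNReal.tsum_mul_left]
    refine tsum_congr fun l => ?_
    simp [hz.ne', hz.le, seqProb, stepP]
  · subst hz
    simp only [lt_irrefl, if_true, if_false, zero_mul, add_zero]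
    rw [← ENNReal.tsum_mul_left]
    refine tsum_congr fun l => ?_
    simp [seqProb, stepP]
  · rw [if_neg hz.ne', if_neg hz.not_gt, zero_add, zero_mul, ENNReal.tsum_eq_zero]
    intro l
    rw [if_neg]
    rintro ⟨-, -, h3⟩
    exact absurd (h3 z (by simp)) hz.not_ge

theorem Lsum_le {b : ℝ≥0∞} (hb : ∀ h, ∑' z, (if z ≤ y then stepP σ M h z else 0) ≤ b)
    (k : ℕ) (h : List Y) : Lsum σ M y k h ≤ b ^ k := by
  induction k generalizing h with
  | zero => simp [Lsum_zero]
  | succ k ih =>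
    rw [Lsum_succ, pow_succ']
    calc _ ≤ ∑' z, (if z ≤ y then stepP σ M h z else 0) * b ^ k :=
          ENNReal.tsum_le_tsum fun z => by gcongr; exact ih _
      _ ≤ _ := by rw [ENNReal.tsum_mul_right]; gcongr; exact hb h

theorem le_Lsum {b : ℝ≥0∞} (hb : ∀ h, b ≤ ∑' z, (if z ≤ y then stepP σ M h z else 0))
    (k : ℕ) (h : List Y) : b ^ k ≤ Lsum σ M y k h := by
  induction k generalizing h with
  | zero => simp [Lsum_zero]
  | succ k ih =>
    rw [Lsum_succ, pow_succ']
    calc _ ≤ ∑' z, (if z ≤ y then stepP σ M h z else 0) * b ^ k := by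
          rw [ENNReal.tsum_mul_right]; gcongr; exact hb h
      _ ≤ _ := ENNReal.tsum_le_tsum fun z => by gcongr; exact ih _

theorem Gsum_le {P a b : ℝ≥0∞} (hP : ∀ h, stepP σ M h y ≤ P)
    (ha : ∀ h, ∑' z, (if z < y then stepP σ M h z else 0) ≤ a)
    (hb : ∀ h, ∑' z, (if z ≤ y then stepP σ M h z else 0) ≤ b)
    (k : ℕ) (h : List Y) : Gsum σ M y k h ≤ P * geoS a b k := by
  induction k generalizing h with
  | zero => simp [Gsum_zero]
  | succ k ih =>
    rw [Gsum_succ]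
    simp only [geoS]
    rw [mul_add]
    refine add_le_add (mul_le_mul' (hP h) (Lsum_le σ M y hb k _)) ?_
    calc _ ≤ ∑' z, (if z < y then stepP σ M h z else 0) * (P * geoS a b k) :=
          ENNReal.tsum_le_tsum fun z => by gcongr; exact ih _
      _ ≤ a * (P * geoS a b k) := by rw [ENNReal.tsum_mul_right]; gcongr; exact ha h
      _ = _ := by ring

theorem le_Gsum {P a b : ℝ≥0∞} (hP : ∀ h, P ≤ stepP σ M h y)
    (ha : ∀ h, a ≤ ∑' z, (if z < y then stepP σ M h z else 0))
    (hb : ∀ h, b ≤ ∑' z, (if z ≤ y then stepP σ M h z else 0))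
    (k : ℕ) (h : List Y) : P * geoS a b k ≤ Gsum σ M y k h := by
  induction k generalizing h with
  | zero => simp [Gsum_zero, geoS]
  | succ k ih =>
    rw [Gsum_succ]
    simp only [geoS]
    rw [mul_add]
    refine add_le_add (mul_le_mul' (hP h) (le_Lsum σ M y hb k _)) ?_
    calc _ = a * (P * geoS a b k) := by ring
      _ ≤ ∑' z, (if z < y then stepP σ M h z else 0) * (P * geoS a b k) := by
          rw [ENNReal.tsum_mul_right]; gcongr; exact ha h
      _ ≤ _ := ENNReal.tsum_le_tsum fun z => by gcongr; exact ih _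

theorem hypoOut_eq (p : ℕ → ℝ≥0∞) :
    hypoOut p σ M y = ∑' k : ℕ, p (k + 1) * Gsum σ M y (k + 1) [] := by
  classical
  unfold hypoOut
  refine tsum_congr fun k => ?_
  congr 1
  unfold Gsum
  refine (tsum_subtype {l : List Y | l.length = k + 1 ∧ l.maximum = (y : WithBot Y)}
    (fun l => seqProb σ M [] l)).trans ?_
  refine tsum_congr fun l => ?_
  simp only [Set.indicator, Set.mem_ofPred_eq, List.maximum_eq_coe_iff]

end adaptive

section facts
variable {Λ Y : Type*} [Fintype Λ]

theorem Pplus_le (c C : ℝ) (M : Λ → Y → ℝ≥0∞) (y : Y) :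
    Pplus c C M y ≤ ENNReal.ofReal (C / Fintype.card Λ) * ∑ l, M l y := by
  unfold Pplus
  refine iSup₂_le fun π hπ => ?_
  rw [Finset.mul_sum]
  exact Finset.sum_le_sum fun l _ => mul_le_mul' (hπ.1 l).2 le_rfl

theorem le_Pminus (c C : ℝ) (M : Λ → Y → ℝ≥0∞) (y : Y) :
    ENNReal.ofReal (c / Fintype.card Λ) * ∑ l, M l y ≤ Pminus c C M y := by
  unfold Pminus
  refine le_iInf₂ fun π hπ => ?_
  rw [Finset.mul_sum]
  exact Finset.sum_le_sum fun l _ => mul_le_mul' (hπ.1 l).1 le_rfl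

theorem step_le {c C : ℝ} {σ : List Y → Λ → ℝ≥0∞} (hσ : IsStrategy c C σ)
    (M : Λ → Y → ℝ≥0∞) (h : List Y) (y : Y) : stepP σ M h y ≤ Pplus c C M y := by
  unfold Pplus stepP
  exact le_iSup₂_of_le (σ h) ⟨(hσ h).2, (hσ h).1⟩ le_rfl

theorem le_step {c C : ℝ} {σ : List Y → Λ → ℝ≥0∞} (hσ : IsStrategy c C σ)
    (M : Λ → Y → ℝ≥0∞) (h : List Y) (y : Y) : Pminus c C M y ≤ stepP σ M h y := by
  unfold Pminus stepP
  exact iInf₂_le_of_le (σ h) ⟨(hσ h).2, (hσ h).1⟩ le_rfl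

theorem tsum_step {c C : ℝ} {σ : List Y → Λ → ℝ≥0∞} (hσ : IsStrategy c C σ)
    {M : Λ → Y → ℝ≥0∞} (hM : ∀ l : Λ, ∑' y : Y, M l y = 1) (h : List Y) :
    ∑' y, stepP σ M h y = 1 := by
  unfold stepP
  rw [Summable.tsum_finsetSum (fun _ _ => ENNReal.summable)]
  simp_rw [ENNReal.tsum_mul_left, hM, mul_one]
  exact (hσ h).1

theorem tsum_Pplus {c C : ℝ} {M : Λ → Y → ℝ≥0∞} (hM : ∀ l : Λ, ∑' y : Y, M l y = 1) :
    ∑' y, Pplus c C M y ≠ ⊤ := by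
  have : ∑' y, Pplus c C M y ≤ ENNReal.ofReal (C / Fintype.card Λ) * ∑ l : Λ, (1 : ℝ≥0∞) := by
    calc _ ≤ ∑' y, ENNReal.ofReal (C / Fintype.card Λ) * ∑ l, M l y :=
          ENNReal.tsum_le_tsum fun y => Pplus_le c C M y
      _ = _ := by
        rw [ENNReal.tsum_mul_left, Summable.tsum_finsetSum (fun _ _ => ENNReal.summable)]
        simp_rw [hM]
  refine ne_top_of_le_ne_top ?_ this
  simp [ENNReal.mul_eq_top]

variable [LinearOrder Y]

theorem tsum_le_split (F : Y → ℝ≥0∞) (y : Y) :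
    ∑' z, (if z ≤ y then F z else 0) = ∑' z, (if z < y then F z else 0) + F y := by
  have : F y = ∑' z, if z = y then F z else 0 := by
    rw [tsum_eq_single y (fun z hz => by simp [hz])]; simp
  rw [this, ← ENNReal.tsum_add]
  refine tsum_congr fun z => ?_
  rcases lt_trichotomy z y with hz | hz | hz
  · simp [hz, hz.le, hz.ne]
  · simp [hz]
  · simp [hz.not_ge, hz.not_gt, hz.ne']

theorem tsum_lt_ofReal {F : Y → ℝ≥0∞} (hF : ∑' z, F z ≠ ⊤) (y : Y) :
    ∑' z, (if z < y then F z else 0) =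
      ENNReal.ofReal (∑' z, if z < y then (F z).toReal else 0) := by
  have hs := ENNReal.summable_toReal hF
  rw [ENNReal.ofReal_tsum_of_nonneg]
  · refine tsum_congr fun z => ?_
    split_ifs
    · rw [ENNReal.ofReal_toReal (ENNReal.ne_top_of_tsum_ne_top hF z)]
    · simp
  · intro z; split_ifs <;> simp
  · refine Summable.of_nonneg_of_le (fun z => ?_) (fun z => ?_) hs
    · split_ifs <;> simp
    · split_ifs <;> simp

theorem tsum_g {F : Y → ℝ} (h0 : ∀ z, 0 ≤ F z) (hF : Summable F) (y : Y) (s v : ℝ) :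
    ∑' z, F z * (if z < y then s else if z = y then v else 0) =
      (∑' z, if z < y then F z else 0) * s + F y * v := by
  have hs : Summable fun z => if z < y then F z else 0 := by
    refine Summable.of_nonneg_of_le (fun z => ?_) (fun z => ?_) hF
    · split_ifs <;> simp [h0]
    · split_ifs <;> simp [h0]
  have h2 : HasSum (fun z => if z = y then F y * v else 0) (F y * v) := hasSum_ite_eq y _
  have := (hs.hasSum.mul_right s).add h2
  rw [← this.tsum_eq]
  refine tsum_congr fun z => ?_
  rcases lt_trichotomy z y with hz | hz | hz
  · simp [hz, hz.ne]
  · simp [hz]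
  · simp [hz.not_gt, hz.ne']

theorem hy_point
    {α c C : ℝ} (hα : 1 < α) (hc : 0 < c) [Nonempty Λ]
    {M M' : Λ → Y → ℝ≥0∞}
    (hM : ∀ l : Λ, ∑' y : Y, M l y = 1) (hM' : ∀ l : Λ, ∑' y : Y, M' l y = 1)
    {w : ℕ → ℝ} {f : ℝ → ℝ} (hw : ∀ k, 0 ≤ w k) (hsum : ∑' k, w k = 1)
    (hm : Summable fun k : ℕ => ((k : ℝ) + 1) * w k)
    (hf : ∀ x : ℝ, f x = ∑' k : ℕ, w k * x ^ (k + 1))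
    {p : ℕ → ℝ≥0∞} (hp : ∀ k : ℕ, p (k + 1) = ENNReal.ofReal (w k))
    {σ σ' : List Y → Λ → ℝ≥0∞}
    (hσ : IsStrategy c C σ) (hσ' : IsStrategy c C σ') (y : Y)
    (hPy : Pplus c C M y ≠ 0) (hRy : Pminus c C M' y ≠ 0) :
    ∃ (g : Y → ℝ) (q q' : ℝ), (∀ y : Y, g y ∈ Set.Icc (0 : ℝ) 1) ∧
      q = ∑' y : Y, (Pplus c C M y).toReal * g y ∧
      q' = ∑' y : Y, (Pminus c C M' y).toReal * g y ∧
      0 < q ∧ q < 1 ∧ 0 < q' ∧ q' < 1 ∧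
      hypoOut p σ M y ^ α * hypoOut p σ' M' y ^ (1 - α) ≤
        (Pplus c C M y ^ α * Pminus c C M' y ^ (1 - α)) *
          ENNReal.ofReal (deriv f q ^ α * deriv f q' ^ (1 - α)) := by
  have hPt := tsum_Pplus (c := c) (C := C) hM
  have hRt : ∑' z, Pminus c C M' z ≠ ⊤ := by
    refine ne_top_of_le_ne_top ENNReal.one_ne_top ?_
    rw [← tsum_step hσ' hM' []]
    exact ENNReal.tsum_le_tsum fun z => le_step hσ' M' [] z
  have hPf : ∀ z, Pplus c C M z ≠ ⊤ := ENNReal.ne_top_of_tsum_ne_top hPt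
  have hRf : ∀ z, Pminus c C M' z ≠ ⊤ := ENNReal.ne_top_of_tsum_ne_top hRt
  set P0 := (Pplus c C M y).toReal with hP0
  set R0 := (Pminus c C M' y).toReal with hR0
  have hP0e : Pplus c C M y = ENNReal.ofReal P0 := (ENNReal.ofReal_toReal (hPf y)).symm
  have hR0e : Pminus c C M' y = ENNReal.ofReal R0 := (ENNReal.ofReal_toReal (hRf y)).symm
  have hP0p : 0 < P0 := ENNReal.toReal_pos hPy (hPf y)
  have hR0p : 0 < R0 := ENNReal.toReal_pos hRy (hRf y)
  -- the lower bound at `y` for `M`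
  have hmne : Pminus c C M y ≠ 0 := by
    intro h
    have h1 := le_Pminus c C M y
    rw [h] at h1
    have h2 : ∑ l, M l y = 0 := by
      rcases mul_eq_zero.1 (le_antisymm h1 bot_le) with h3 | h3
      · exfalso
        have : 0 < c / Fintype.card Λ := by
          have : 0 < Fintype.card Λ := Fintype.card_pos
          positivity
        exact absurd (ENNReal.ofReal_eq_zero.1 h3) (not_le.2 this)
      · exact h3
    have h4 := Pplus_le c C M y
    rw [h2, mul_zero] at h4
    exact hPy (le_antisymm h4 bot_le)
  have hmle : Pminus c C M y ≤ Pplus c C M y := (le_step hσ M [] y).trans (step_le hσ M [] y)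
  have hmf : Pminus c C M y ≠ ⊤ := ne_top_of_le_ne_top (hPf y) hmle
  set m0 := (Pminus c C M y).toReal with hm0
  have hm0e : Pminus c C M y = ENNReal.ofReal m0 := (ENNReal.ofReal_toReal hmf).symm
  have hm0p : 0 < m0 := ENNReal.toReal_pos hmne hmf
  have hm0P : m0 ≤ P0 := (ENNReal.toReal_le_toReal hmf (hPf y)).2 hmle
  have le1 : ∀ (σ : List Y → Λ → ℝ≥0∞) (M : Λ → Y → ℝ≥0∞), IsStrategy c C σ →
      (∀ l : Λ, ∑' y : Y, M l y = 1) → ∀ h : List Y,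
      ∑' z, (if z ≤ y then stepP σ M h z else 0) ≤ 1 := by
    intro σ M hσ hM h
    rw [← tsum_step hσ hM h]
    refine ENNReal.tsum_le_tsum fun z => ?_
    split_ifs <;> simp
  have hm01 : m0 ≤ 1 := by
    have h1 := le1 σ M hσ hM []
    rw [tsum_le_split] at h1
    have h2 : ENNReal.ofReal m0 ≤ 1 := by
      rw [← hm0e]
      exact (le_step hσ M [] y).trans (le_trans le_add_self h1)
    simpa using h2
  set X := ∑' z, if z < y then (Pplus c C M z).toReal else 0 with hX
  set X' := ∑' z, if z < y then (Pminus c C M' z).toReal else 0 with hX'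
  have hXe := tsum_lt_ofReal hPt y
  have hXe' := tsum_lt_ofReal hRt y
  rw [← hX] at hXe
  rw [← hX'] at hXe'
  have hX0 : 0 ≤ X := tsum_nonneg fun z => by split_ifs <;> simp
  have hX0' : 0 ≤ X' := tsum_nonneg fun z => by split_ifs <;> simp
  have hlow' : ∀ h, ENNReal.ofReal (X' + R0) ≤
      ∑' z, (if z ≤ y then stepP σ' M' h z else 0) := by
    intro h
    rw [tsum_le_split, ENNReal.ofReal_add hX0' hR0p.le, ← hXe', ← hR0e]
    refine add_le_add (ENNReal.tsum_le_tsum fun z => ?_) (le_step hσ' M' h y)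
    split_ifs
    · exact le_step hσ' M' h z
    · simp
  have hXR : X' + R0 ≤ 1 := by
    have := (hlow' []).trans (le1 σ' M' hσ' hM' [])
    simpa using this
  set a := min (1 - m0) X with ha
  set b := min 1 (X + P0) with hb
  have ha0 : 0 ≤ a := le_min (by linarith) hX0
  have hab : a < b := by
    rw [hb, lt_min_iff]
    exact ⟨lt_of_le_of_lt (min_le_left _ _) (by linarith),
      lt_of_le_of_lt (min_le_right _ _) (by linarith)⟩
  have hb1 : b ≤ 1 := min_le_left _ _
  have hbaP : b - a ≤ P0 := by
    rcases min_choice (1 - m0) X with h | h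
    · rw [ha, h]; linarith
    · rw [ha, h]; linarith [min_le_right 1 (X + P0)]
  set s := a / X with hs
  have hsX : X * s = a := by
    rcases hX0.eq_or_lt with h | h
    · have : a ≤ 0 := (min_le_right _ _).trans h.symm.le
      rw [← h]; linarith
    · rw [hs]; field_simp
  have hs0 : 0 ≤ s := by positivity
  have hs1 : s ≤ 1 := div_le_one_of_le₀ (min_le_right _ _) hX0
  set t := (b - a) / P0 with ht
  have htp : 0 < t := div_pos (by linarith) hP0p
  have ht1 : t ≤ 1 := div_le_one_of_le₀ hbaP hP0p.le
  have htP : P0 * t = b - a := by rw [ht]; field_simp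
  set a' := X' * s with ha'
  set b' := a' + R0 * t with hb'
  have ha0' : 0 ≤ a' := by positivity
  have htR : 0 < R0 * t := by positivity
  have hab' : a' < b' := by linarith
  have haX' : a' ≤ X' := mul_le_of_le_one_right hX0' hs1
  have hbX' : b' ≤ X' + R0 := add_le_add haX' (mul_le_of_le_one_right hR0p.le ht1)
  have hb1' : b' ≤ 1 := hbX'.trans hXR
  obtain ⟨u, hu0, hu1, hcore⟩ := hy_core hα hw hsum hm hf ha0 hab hb1 ha0' hab' hb1'
  have hq : a + u * (b - a) = ∑' z : Y, (Pplus c C M z).toReal *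
      (if z < y then s else if z = y then u * t else 0) := by
    rw [tsum_g (fun z => ENNReal.toReal_nonneg) (ENNReal.summable_toReal hPt) y s (u * t),
      ← hX, hsX, ← hP0, ← htP]
    ring
  have hq' : a' + u * (b' - a') = ∑' z : Y, (Pminus c C M' z).toReal *
      (if z < y then s else if z = y then u * t else 0) := by
    rw [tsum_g (fun z => ENNReal.toReal_nonneg) (ENNReal.summable_toReal hRt) y s (u * t),
      ← hX', ← ha', ← hR0, hb']
    ring
  refine ⟨fun z => if z < y then s else if z = y then u * t else 0,
    a + u * (b - a), a' + u * (b' - a'), ?_, hq, hq', ?_, ?_, ?_, ?_, ?_⟩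
  · intro z
    dsimp only
    split_ifs
    · exact ⟨hs0, hs1⟩
    · exact ⟨by positivity, mul_le_one₀ hu1.le htp.le ht1⟩
    · simp
  · have : 0 < u * (b - a) := mul_pos hu0 (by linarith)
    linarith
  · nlinarith
  · have : 0 < u * (b' - a') := mul_pos hu0 (by linarith)
    linarith
  · nlinarith
  · set A := (f b - f a) / (b - a) with hA
    set B := (f b' - f a') / (b' - a') with hB
    have hAp : 0 < A := hy_slope_pos hw hsum hm hf ha0 hab hb1
    have hBp : 0 < B := hy_slope_pos hw hsum hm hf ha0' hab' hb1'
    have h1 : hypoOut p σ M y ≤ ENNReal.ofReal P0 * ENNReal.ofReal A := by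
      rw [hypoOut_eq, hA, ← hy_tsum_geo hw hm hf ha0 hab hb1]
      refine ENNReal.tsum_le_tsum fun k => ?_
      rw [hp]
      refine mul_le_mul' le_rfl (Gsum_le σ M y ?_ ?_ ?_ _ _)
      · intro h
        rw [← hP0e]; exact step_le hσ M h y
      · intro h
        rw [ha, ENNReal.ofReal_min]
        refine le_min ?_ ?_
        · rw [ENNReal.ofReal_sub _ hm0p.le, ENNReal.ofReal_one, ← hm0e]
          refine ENNReal.le_sub_of_add_le_right hmf ?_
          refine le_trans ?_ (le1 σ M hσ hM h)
          rw [tsum_le_split]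
          exact add_le_add le_rfl (le_step hσ M h y)
        · rw [← hXe]
          refine ENNReal.tsum_le_tsum fun z => ?_
          split_ifs
          · exact step_le hσ M h z
          · simp
      · intro h
        rw [hb, ENNReal.ofReal_min]
        refine le_min (by simpa using le1 σ M hσ hM h) ?_
        rw [tsum_le_split, ENNReal.ofReal_add hX0 hP0p.le, ← hXe, ← hP0e]
        refine add_le_add (ENNReal.tsum_le_tsum fun z => ?_) (step_le hσ M h y)
        split_ifs
        · exact step_le hσ M h z
        · simp
    have h2 : ENNReal.ofReal R0 * ENNReal.ofReal B ≤ hypoOut p σ' M' y := by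
      rw [hypoOut_eq, hB, ← hy_tsum_geo hw hm hf ha0' hab' hb1']
      refine ENNReal.tsum_le_tsum fun k => ?_
      rw [hp]
      refine mul_le_mul' le_rfl (le_Gsum σ' M' y ?_ ?_ ?_ _ _)
      · intro h
        rw [← hR0e]; exact le_step hσ' M' h y
      · intro h
        refine (ENNReal.ofReal_le_ofReal haX').trans ?_
        rw [← hXe']
        refine ENNReal.tsum_le_tsum fun z => ?_
        split_ifs
        · exact le_step hσ' M' h z
        · simp
      · intro h
        exact (ENNReal.ofReal_le_ofReal hbX').trans (hlow' h)
    calc _ ≤ (ENNReal.ofReal P0 * ENNReal.ofReal A) ^ α *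
          (ENNReal.ofReal R0 * ENNReal.ofReal B) ^ (1 - α) :=
          mul_le_mul' (ENNReal.rpow_le_rpow h1 (by linarith)) (hy_rpow_anti hα h2)
      _ = (ENNReal.ofReal P0 ^ α * ENNReal.ofReal R0 ^ (1 - α)) *
          (ENNReal.ofReal (A ^ α * B ^ (1 - α))) := by
          rw [ENNReal.mul_rpow_of_ne_top (by simp) (by simp),
            ENNReal.mul_rpow_of_ne_top (by simp) (by simp),
            ENNReal.ofReal_mul (by positivity), ← ENNReal.ofReal_rpow_of_pos hAp,
            ← ENNReal.ofReal_rpow_of_pos hBp]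
          ring
      _ ≤ _ := by
          rw [hP0e, hR0e]
          exact mul_le_mul' le_rfl (ENNReal.ofReal_le_ofReal hcore)

end facts

section concl
variable {Λ Y : Type*} [Fintype Λ]

theorem hy_Wsum [Nonempty Λ] {α c C : ℝ} (hα : 1 < α) (hc : 0 < c) (hcC : c ≤ C)
    {M M' : Λ → Y → ℝ≥0∞} (hM' : ∀ l : Λ, ∑' y : Y, M' l y = 1)
    {σ : List Y → Λ → ℝ≥0∞} (hσ : IsStrategy c C σ) {E : ℝ≥0∞}
    (hE : ∀ l, ∑' y, M l y ^ α * M' l y ^ (1 - α) ≤ E) :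
    ∑' y, Pplus c C M y ^ α * Pminus c C M' y ^ (1 - α) ≤ ENNReal.ofReal ((C / c) ^ α) * E := by
  have hC : 0 < C := by linarith
  have hNn : 0 < Fintype.card Λ := Fintype.card_pos
  set N : ℝ := (Fintype.card Λ : ℝ) with hN
  have hN0 : 0 < N := by rw [hN]; exact_mod_cast hNn
  have hcN : 0 < c / N := by positivity
  have hCN : 0 < C / N := by positivity
  have hc1 : c ≤ 1 := by
    have h1 : ∑ l : Λ, ENNReal.ofReal (c / N) ≤ 1 := by
      rw [← (hσ []).1]
      exact Finset.sum_le_sum fun l _ => ((hσ []).2 l).1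
    rw [← ENNReal.ofReal_sum_of_nonneg (fun _ _ => hcN.le)] at h1
    have h2 : ∑ _l : Λ, c / N = c := by
      rw [Finset.sum_const, Finset.card_univ, nsmul_eq_mul, ← hN]; field_simp
    rw [h2] at h1
    simpa using h1
  set κ := ENNReal.ofReal (C / N) ^ α * ENNReal.ofReal (c / N) ^ (1 - α) with hκ
  have hpt : ∀ y, Pplus c C M y ^ α * Pminus c C M' y ^ (1 - α) ≤
      κ * ∑ l, M l y ^ α * M' l y ^ (1 - α) := by
    intro y
    have hfin : ∑ l, M' l y ≠ ⊤ := by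
      rw [ENNReal.sum_ne_top]
      intro l _
      exact ENNReal.ne_top_of_tsum_ne_top (by rw [hM' l]; simp) y
    have hh := hy_holder hα (fun l => M l y) (fun l => M' l y) (by rwa [tsum_fintype])
    simp only [tsum_fintype] at hh
    calc _ ≤ (ENNReal.ofReal (C / N) * ∑ l, M l y) ^ α *
          (ENNReal.ofReal (c / N) * ∑ l, M' l y) ^ (1 - α) :=
          mul_le_mul' (ENNReal.rpow_le_rpow (Pplus_le c C M y) (by linarith))
            (hy_rpow_anti hα (le_Pminus c C M' y))
      _ = κ * ((∑ l, M l y) ^ α * (∑ l, M' l y) ^ (1 - α)) := by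
          rw [ENNReal.mul_rpow_of_nonneg _ _ (by linarith),
            ENNReal.mul_rpow_of_ne_top (by simp) hfin]
          ring
      _ ≤ _ := mul_le_mul' le_rfl hh
  calc _ ≤ ∑' y, κ * ∑ l, M l y ^ α * M' l y ^ (1 - α) := ENNReal.tsum_le_tsum hpt
    _ = κ * ∑ l, ∑' y, M l y ^ α * M' l y ^ (1 - α) := by
        rw [ENNReal.tsum_mul_left, Summable.tsum_finsetSum (fun _ _ => ENNReal.summable)]
    _ ≤ κ * ∑ _l : Λ, E := mul_le_mul' le_rfl (Finset.sum_le_sum fun l _ => hE l)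
    _ = (κ * ENNReal.ofReal N) * E := by
        rw [Finset.sum_const, Finset.card_univ, nsmul_eq_mul, hN, ENNReal.ofReal_natCast]
        ring
    _ ≤ _ := by
        refine mul_le_mul' ?_ le_rfl
        rw [hκ, ENNReal.ofReal_rpow_of_pos hCN, ENNReal.ofReal_rpow_of_pos hcN,
          ← ENNReal.ofReal_mul (by positivity), ← ENNReal.ofReal_mul (by positivity)]
        refine ENNReal.ofReal_le_ofReal ?_
        have e : C / N = (C / c) * (c / N) := by field_simp
        rw [e, Real.mul_rpow (by positivity) hcN.le, mul_assoc ((C / c) ^ α),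
          ← Real.rpow_add hcN]
        have e2 : (c / N) ^ (α + (1 - α)) = c / N := by
          have : α + (1 - α) = 1 := by ring
          rw [this, Real.rpow_one]
        rw [e2, mul_assoc, div_mul_cancel₀ _ hN0.ne']
        exact mul_le_of_le_one_right (by positivity) hc1

theorem hy_V_bound {α : ℝ} (hα : 1 < α) {w : ℕ → ℝ} {f : ℝ → ℝ} (hw : ∀ k, 0 ≤ w k)
    (hsum : ∑' k, w k = 1) (hm : Summable fun k : ℕ => ((k : ℝ) + 1) * w k)
    (hf : ∀ x : ℝ, f x = ∑' k : ℕ, w k * x ^ (k + 1)) {P R : Y → ℝ≥0∞}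
    (hP : ∑' z, P z ≠ ⊤) (hR : ∑' z, R z ≠ ⊤) (hW : ∑' z, P z ^ α * R z ^ (1 - α) ≠ ⊤) :
    ∃ Bd : ℝ≥0∞, Bd ≠ ⊤ ∧ ∀ (g : Y → ℝ) (q q' : ℝ), (∀ y : Y, g y ∈ Set.Icc (0 : ℝ) 1) →
      q = ∑' y : Y, (P y).toReal * g y → q' = ∑' y : Y, (R y).toReal * g y →
      0 < q → q < 1 → 0 < q' → q' < 1 →
      ENNReal.ofReal (deriv f q ^ α * deriv f q' ^ (1 - α)) ≤ Bd := by
  obtain ⟨m, κ, μ, hκ, hμ, hbd⟩ := hy_deriv_bounds hw hsum hm hf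
  refine ⟨ENNReal.ofReal (μ ^ α * κ ^ (1 - α)) * (∑' z, P z ^ α * R z ^ (1 - α)) ^ m,
    ENNReal.mul_ne_top (by simp) (ENNReal.pow_ne_top hW), ?_⟩
  intro g q q' hg hq hq' hq0 hq1 hq0' hq1'
  have conv : ∀ F : Y → ℝ≥0∞, ∑' z, F z ≠ ⊤ →
      ENNReal.ofReal (∑' y : Y, (F y).toReal * g y) = ∑' y, F y * ENNReal.ofReal (g y) := by
    intro F hF
    rw [ENNReal.ofReal_tsum_of_nonneg (fun y => mul_nonneg ENNReal.toReal_nonneg (hg y).1)]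
    · refine tsum_congr fun y => ?_
      rw [ENNReal.ofReal_mul ENNReal.toReal_nonneg,
        ENNReal.ofReal_toReal (ENNReal.ne_top_of_tsum_ne_top hF y)]
    · exact Summable.of_nonneg_of_le (fun y => mul_nonneg ENNReal.toReal_nonneg (hg y).1)
        (fun y => mul_le_of_le_one_right ENNReal.toReal_nonneg (hg y).2)
        (ENNReal.summable_toReal hF)
  have h1 : ENNReal.ofReal (q ^ α * q' ^ (1 - α)) ≤ ∑' z, P z ^ α * R z ^ (1 - α) := by
    rw [ENNReal.ofReal_mul (by positivity), ← ENNReal.ofReal_rpow_of_pos hq0,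
      ← ENNReal.ofReal_rpow_of_pos hq0']
    have hRg : ∑' y, R y * ENNReal.ofReal (g y) ≠ ⊤ := by
      rw [← conv R hR]; simp
    rw [hq, hq', conv P hP, conv R hR]
    refine (hy_holder hα _ _ hRg).trans (ENNReal.tsum_le_tsum fun y => ?_)
    rcases (hg y).1.eq_or_lt with h0 | h0
    · rw [← h0]
      have : (0 : ℝ≥0∞) ^ α = 0 := ENNReal.zero_rpow_of_pos (by linarith)
      simp [this]
    · have hne : ENNReal.ofReal (g y) ≠ 0 := by simpa using h0
      rw [ENNReal.mul_rpow_of_nonneg _ _ (by linarith),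
        ENNReal.mul_rpow_of_ne_top (ENNReal.ne_top_of_tsum_ne_top hR y) (by simp)]
      calc _ = P y ^ α * R y ^ (1 - α) *
            (ENNReal.ofReal (g y) ^ α * ENNReal.ofReal (g y) ^ (1 - α)) := by ring
        _ ≤ _ := by
          rw [← ENNReal.rpow_add _ _ hne (by simp)]
          have : α + (1 - α) = 1 := by ring
          rw [this, ENNReal.rpow_one]
          exact mul_le_of_le_one_right' (by simpa using (hg y).2)
  have b1 := hbd q hq0 hq1
  have b2 := hbd q' hq0' hq1'
  have d1 := hy_deriv_pos hw hsum hm hf hq0 hq1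
  have hv : deriv f q ^ α * deriv f q' ^ (1 - α) ≤
      μ ^ α * κ ^ (1 - α) * (q ^ α * q' ^ (1 - α)) ^ m := by
    calc _ ≤ (μ * q ^ m) ^ α * (κ * q' ^ m) ^ (1 - α) := by
          refine mul_le_mul (Real.rpow_le_rpow d1.le b1.2 (by linarith))
            (Real.rpow_le_rpow_of_nonpos (by positivity) b2.1 (by linarith)) ?_ (by positivity)
          exact Real.rpow_nonneg (hy_deriv_pos hw hsum hm hf hq0' hq1').le _
      _ = _ := by
          rw [Real.mul_rpow hμ.le (by positivity), Real.mul_rpow hκ.le (by positivity), mul_pow,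
            ← Real.rpow_natCast q, ← Real.rpow_natCast q', ← Real.rpow_mul hq0.le,
            ← Real.rpow_mul hq0'.le, ← Real.rpow_natCast (q ^ α),
            ← Real.rpow_natCast (q' ^ (1 - α)),
            ← Real.rpow_mul hq0.le, ← Real.rpow_mul hq0'.le, mul_comm (m : ℝ), mul_comm (m : ℝ)]
          ring
  calc _ ≤ ENNReal.ofReal (μ ^ α * κ ^ (1 - α) * (q ^ α * q' ^ (1 - α)) ^ m) :=
        ENNReal.ofReal_le_ofReal hv
    _ = ENNReal.ofReal (μ ^ α * κ ^ (1 - α)) * ENNReal.ofReal (q ^ α * q' ^ (1 - α)) ^ m := by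
        rw [ENNReal.ofReal_mul (by positivity), ENNReal.ofReal_pow (by positivity)]
    _ ≤ _ := by gcongr

/-- some value of a weighted average is at least the average. -/
theorem hy_average {T W : Y → ℝ≥0∞} {V : Set ℝ≥0∞} {Bd : ℝ≥0∞} (hBd : Bd ≠ ⊤)
    (hV : ∀ v ∈ V, v ≤ Bd) (hW : ∑' y, W y ≠ ⊤) (hT : ∑' y, T y ≠ 0)
    (h : ∀ y, T y ≠ 0 → ∃ v ∈ V, T y ≤ W y * v) :
    ∃ v ∈ V, ∑' y, T y ≤ (∑' y, W y) * v := by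
  by_contra! hcon
  have hS : ∑' y, T y ≠ ⊤ := by
    refine ne_top_of_le_ne_top (ENNReal.mul_ne_top hW hBd) ?_
    rw [← ENNReal.tsum_mul_right]
    refine ENNReal.tsum_le_tsum fun y => ?_
    by_cases h0 : T y = 0
    · simp [h0]
    · obtain ⟨v, hv, hle⟩ := h y h0
      exact hle.trans (mul_le_mul' le_rfl (hV v hv))
  have hstrict : ∀ y, T y ≠ 0 → T y * (∑' y, W y) < W y * ∑' y, T y := by
    intro y h0
    obtain ⟨v, hv, hle⟩ := h y h0
    have hWy : W y ≠ 0 := by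
      intro hz
      rw [hz, zero_mul] at hle
      exact h0 (le_antisymm hle bot_le)
    have hWt : W y ≠ ⊤ := ENNReal.ne_top_of_tsum_ne_top hW y
    calc T y * (∑' y, W y) ≤ W y * v * ∑' y, W y := mul_le_mul' hle le_rfl
      _ = W y * ((∑' y, W y) * v) := by ring
      _ < _ := (ENNReal.mul_lt_mul_iff_right hWy hWt).2 (hcon v hv)
  have hex : ∃ y, T y ≠ 0 := by
    by_contra! hz
    exact hT (ENNReal.tsum_eq_zero.2 hz)
  obtain ⟨y, hy⟩ := hex
  have := ENNReal.tsum_lt_tsum (f := fun y => T y * (∑' y, W y))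
    (g := fun y => W y * ∑' y, T y) (i := y)
    (by rw [ENNReal.tsum_mul_right]; exact ENNReal.mul_ne_top hS hW)
    (fun z => by
      by_cases h0 : T z = 0
      · simp [h0]
      · exact (hstrict z h0).le) (hstrict y hy)
  rw [ENNReal.tsum_mul_right, ENNReal.tsum_mul_right, mul_comm] at this
  exact lt_irrefl _ this

theorem hypoOut_zero [LinearOrder Y] {c C : ℝ} {M : Λ → Y → ℝ≥0∞} {p : ℕ → ℝ≥0∞}
    {σ : List Y → Λ → ℝ≥0∞} (hσ : IsStrategy c C σ) {y : Y} (h : Pplus c C M y = 0) :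
    hypoOut p σ M y = 0 := by
  rw [hypoOut_eq, ENNReal.tsum_eq_zero]
  intro k
  have := Gsum_le σ M y (P := 0) (a := ⊤) (b := ⊤)
    (fun hh => (step_le hσ M hh y).trans h.le) (fun _ => le_top) (fun _ => le_top) (k + 1) []
  rw [zero_mul] at this
  rw [le_antisymm this bot_le, mul_zero]

end concl
/-- **Key lemma for adaptive hyperparameter tuning with a general stopping distribution.**
With `f` the probability generating function of the number of runs, there is a
post-processing `g : Y → [0,1]` such that, with `q = 𝔼_{P⁺}[g]` and `q' = 𝔼_{P'⁻}[g]`,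
`D_α(A₁‖A₂) ≤ sup_λ D_α(M_λ‖M'_λ) + (α/(α-1)) log(C/c)
  + (1/(α-1)) log(f'(q)^α f'(q')^{1-α})`. -/
theorem dp_hypo_key_lemma {Λ Y : Type*} [Fintype Λ] [Nonempty Λ]
    [Countable Y] [LinearOrder Y]
    (α c C : ℝ) (hα : 1 < α) (hc : 0 < c) (hcC : c ≤ C)
    (M M' : Λ → Y → ℝ≥0∞)
    (hM : ∀ l : Λ, ∑' y : Y, M l y = 1) (hM' : ∀ l : Λ, ∑' y : Y, M' l y = 1)
    (preal : ℕ → ℝ) (hpreal : ∀ k : ℕ, 0 ≤ preal (k + 1))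
    (hpsum : ∑' k : ℕ, preal (k + 1) = 1)
    (hpmean : Summable fun k : ℕ => ((k : ℝ) + 1) * preal (k + 1))
    (f : ℝ → ℝ) (hf : ∀ x : ℝ, f x = ∑' k : ℕ, preal (k + 1) * x ^ (k + 1))
    (p : ℕ → ℝ≥0∞) (hp : ∀ k : ℕ, p (k + 1) = ENNReal.ofReal (preal (k + 1)))
    (σ σ' : List Y → Λ → ℝ≥0∞)
    (hσ : IsStrategy c C σ) (hσ' : IsStrategy c C σ') :
    ∃ g : Y → ℝ, (∀ y : Y, g y ∈ Set.Icc (0 : ℝ) 1) ∧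
      renyiDiv α (hypoOut p σ M) (hypoOut p σ' M') ≤
        (⨆ l : Λ, renyiDiv α (M l) (M' l))
        + ((α / (α - 1) * Real.log (C / c) : ℝ) : EReal)
        + (((α - 1)⁻¹ * Real.log
            (deriv f (∑' y : Y, (Pplus c C M y).toReal * g y) ^ α *
             deriv f (∑' y : Y, (Pminus c C M' y).toReal * g y) ^ (1 - α)) : ℝ) : EReal) := by
  have hα1 : 0 < α - 1 := by linarith
  have hαi : 0 < (α - 1)⁻¹ := by positivity
  have hC : 0 < C := by linarith
  set E : Λ → ℝ≥0∞ := fun l => ∑' y, M l y ^ α * M' l y ^ (1 - α) with hEdef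
  obtain ⟨l0, hl0⟩ := Finite.exists_max E
  have hren : ∀ p q : Y → ℝ≥0∞, renyiDiv α p q =
      (((α - 1)⁻¹ : ℝ) : EReal) * ENNReal.log (∑' y, p y ^ α * q y ^ (1 - α)) := by
    intro p q
    unfold renyiDiv
    rw [if_neg hα.ne']
  have hsup : renyiDiv α (M l0) (M' l0) ≤ ⨆ l : Λ, renyiDiv α (M l) (M' l) :=
    le_iSup (fun l : Λ => renyiDiv α (M l) (M' l)) l0
  set T : Y → ℝ≥0∞ := fun y => hypoOut p σ M y ^ α * hypoOut p σ' M' y ^ (1 - α) with hTdef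
  set W : Y → ℝ≥0∞ := fun y => Pplus c C M y ^ α * Pminus c C M' y ^ (1 - α) with hWdef
  have hWE : ∑' y, W y ≤ ENNReal.ofReal ((C / c) ^ α) * E l0 :=
    hy_Wsum hα hc hcC hM' hσ hl0
  by_cases hEt : E l0 = ⊤
  · refine ⟨fun _ => 0, fun _ => by simp, ?_⟩
    have : renyiDiv α (M l0) (M' l0) = ⊤ := by
      rw [hren]
      change _ * ENNReal.log (E l0) = ⊤
      rw [hEt, ENNReal.log_top, EReal.coe_mul_top_of_pos hαi]
    rw [this, top_le_iff] at hsup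
    rw [hsup, EReal.top_add_coe, EReal.top_add_coe]
    exact le_top
  by_cases hT0 : ∑' y, T y = 0
  · refine ⟨fun _ => 0, fun _ => by simp, ?_⟩
    rw [hren]
    change _ * ENNReal.log (∑' y, T y) ≤ _
    rw [hT0, ENNReal.log_zero, EReal.coe_mul_bot_of_pos hαi]
    exact bot_le
  have hWt : ∑' y, W y ≠ ⊤ := ne_top_of_le_ne_top (ENNReal.mul_ne_top (by simp) hEt) hWE
  have hRt : ∑' z, Pminus c C M' z ≠ ⊤ := by
    refine ne_top_of_le_ne_top ENNReal.one_ne_top ?_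
    rw [← tsum_step hσ' hM' []]
    exact ENNReal.tsum_le_tsum fun z => le_step hσ' M' [] z
  obtain ⟨Bd, hBd, hbound⟩ := hy_V_bound hα hpreal hpsum hpmean hf
    (tsum_Pplus (c := c) (C := C) hM) hRt hWt
  obtain ⟨v, ⟨g, q, q', hg, hq, hq', hq0, hq1, hq0', hq1', rfl⟩, hv⟩ :=
    hy_average (T := T) (W := W)
      (V := {v | ∃ (g : Y → ℝ) (q q' : ℝ), (∀ y : Y, g y ∈ Set.Icc (0 : ℝ) 1) ∧
        q = ∑' y : Y, (Pplus c C M y).toReal * g y ∧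
        q' = ∑' y : Y, (Pminus c C M' y).toReal * g y ∧
        0 < q ∧ q < 1 ∧ 0 < q' ∧ q' < 1 ∧
        v = ENNReal.ofReal (deriv f q ^ α * deriv f q' ^ (1 - α))}) hBd
      (by
        rintro v ⟨g, q, q', hg, hq, hq', hq0, hq1, hq0', hq1', rfl⟩
        exact hbound g q q' hg hq hq' hq0 hq1 hq0' hq1')
      hWt hT0
      (by
        intro y hy
        have hPy : Pplus c C M y ≠ 0 := by
          intro h0
          apply hy
          simp only [hTdef]
          rw [hypoOut_zero hσ h0, ENNReal.zero_rpow_of_pos (by linarith), zero_mul]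
        have hRy : Pminus c C M' y ≠ 0 := by
          intro h0
          apply ENNReal.ne_top_of_tsum_ne_top hWt y
          simp only [hWdef]
          rw [h0, ENNReal.zero_rpow_of_neg (by linarith), ENNReal.mul_top]
          simp only [ne_eq, ENNReal.rpow_eq_zero_iff, not_or, not_and]
          exact ⟨fun h => absurd h hPy, fun _ => by linarith⟩
        obtain ⟨g, q, q', hg, hq, hq', hq0, hq1, hq0', hq1', hle⟩ :=
          hy_point hα hc hM hM' hpreal hpsum hpmean hf hp hσ hσ' y hPy hRy
        exact ⟨_, ⟨g, q, q', hg, hq, hq', hq0, hq1, hq0', hq1', rfl⟩, hle⟩)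
  refine ⟨g, hg, ?_⟩
  rw [← hq, ← hq', hren]
  change _ * ENNReal.log (∑' y, T y) ≤ _
  have d1 := hy_deriv_pos hpreal hpsum hpmean hf hq0 hq1
  have d2 := hy_deriv_pos hpreal hpsum hpmean hf hq0' hq1'
  set V := deriv f q ^ α * deriv f q' ^ (1 - α) with hVdef
  have hVp : 0 < V := by positivity
  have hKp : 0 < (C / c) ^ α := by positivity
  have hfin : ∑' y, T y ≤ E l0 * ENNReal.ofReal ((C / c) ^ α) * ENNReal.ofReal V :=
    hv.trans (mul_le_mul' (hWE.trans (mul_comm _ _).le) le_rfl)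
  have hlog := ENNReal.log_le_log hfin
  rw [ENNReal.log_mul_add, ENNReal.log_mul_add, ENNReal.log_ofReal_of_pos hKp,
    ENNReal.log_ofReal_of_pos hVp] at hlog
  have hi0 : (0 : EReal) ≤ (((α - 1)⁻¹ : ℝ) : EReal) := by exact_mod_cast hαi.le
  refine (mul_le_mul_of_nonneg_left hlog hi0).trans ?_
  rw [EReal.left_distrib_of_nonneg_of_ne_top hi0 (EReal.coe_ne_top _),
    EReal.left_distrib_of_nonneg_of_ne_top hi0 (EReal.coe_ne_top _)]
  have e1 : (((α - 1)⁻¹ : ℝ) : EReal) * ((Real.log ((C / c) ^ α) : ℝ) : EReal) =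
      ((α / (α - 1) * Real.log (C / c) : ℝ) : EReal) := by
    rw [← EReal.coe_mul, Real.log_rpow (by positivity)]
    congr 1
    ring
  rw [e1, ← EReal.coe_mul]
  refine add_le_add (add_le_add ?_ le_rfl) le_rfl
  rw [← hren]
  exact hsup
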